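/- Let X = (X^1,...,X^N) be exchangeable random variables in R^d with joint law in P_1((R^d)^N), and let ν ∈ P_1(R^d). For any q ∈ {1,...,N}, letting μ^{N,q} denote the law of (X^1,...,X^q) and m(X) the empirical measure of the N coordinates, one has W_1(μ^{N,q}, ν^{⊗q}) ≤ q·E[W_1(m(X), ν)] + 2(q^3/N)·M_1(μ^{N,1}), where M_1(μ^{N,1}) = E[‖X^1‖] and W_1 on the product space uses the ℓ_2 product metric. -/

import Mathlib

open MeasureTheory ENNReal

noncomputable section

abbrev Ed (d : ℕ) := EuclideanSpace ℝ (Fin d)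

/-- Optimal transport cost between two measures for a given cost function. -/
def Wc {X Y : Type*} [MeasurableSpace X] [MeasurableSpace Y] (cost : X → Y → ℝ)
    (μ : Measure X) (ν : Measure Y) : ℝ :=
  sInf {r | ∃ γ : Measure (X × Y), γ.map Prod.fst = μ ∧ γ.map Prod.snd = ν ∧
    r = ∫ p, cost p.1 p.2 ∂γ}

/-- 1-Wasserstein distance. -/
def W1 {X : Type*} [MeasurableSpace X] [PseudoMetricSpace X] (μ ν : Measure X) : ℝ :=
  Wc dist μ ν

/-- ℓ₂ product cost on (ℝ^d)^q. -/
def l2cost {d q : ℕ} (x y : Fin q → Ed d) : ℝ := Real.sqrt (∑ i, ‖x i - y i‖ ^ 2)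

/-- 1-Wasserstein distance on the product space with the ℓ₂ product metric. -/
def W1q {d q : ℕ} (μ ν : Measure (Fin q → Ed d)) : ℝ := Wc l2cost μ ν

/-- Empirical measure of `N` points. -/
def emp {X : Type*} [MeasurableSpace X] {N : ℕ} (x : Fin N → X) : Measure X :=
  (N : ℝ≥0∞)⁻¹ • ∑ i, Measure.dirac (x i)

/-- Membership in P₁: probability with finite first moment. -/
def memP1 {X : Type*} [MeasurableSpace X] [NormedAddCommGroup X] (μ : Measure X) : Prop :=
  IsProbabilityMeasure μ ∧ HasFiniteIntegral (fun x => ‖x‖) μ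

open ProbabilityTheory

/-- Uniform measure on `Fin N`. -/
def UN (N : ℕ) : Measure (Fin N) := emp (id : Fin N → Fin N)

/-- Couplings of the uniform measure on indices with `ν`. -/
def IsCpl {d N : ℕ} (ν : Measure (Ed d)) (ρ : Measure (Fin N × Ed d)) : Prop :=
  ρ.map Prod.fst = UN N ∧ ρ.map Prod.snd = ν

lemma emp_prob {X : Type*} [MeasurableSpace X] {N : ℕ} (hN : 0 < N) (x : Fin N → X) :
    IsProbabilityMeasure (emp x) := by
  constructor
  simp [emp]
  exact ENNReal.inv_mul_cancel (by simpa using hN.ne') (by simp)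

lemma UN_map {X : Type*} [MeasurableSpace X] {N : ℕ} (x : Fin N → X) :
    (UN N).map x = emp x := by
  have hx : Measurable x := measurable_of_finite x
  ext s hs
  rw [Measure.map_apply hx hs]
  simp [UN, emp, hs, Measure.dirac_apply', Set.indicator]
  rfl

lemma lift_cpl {d N : ℕ} (hN : 0 < N) (x : Fin N → Ed d) (γ : Measure (Ed d × Ed d))
    (h1 : γ.map Prod.fst = emp x) :
    ∃ ρ : Measure (Fin N × Ed d), ρ.map Prod.fst = UN N ∧
      ρ.map (fun p => (x p.1, p.2)) = γ := by
  have hx : Measurable x := measurable_of_finite x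
  have : IsProbabilityMeasure (emp x) := emp_prob hN x
  have : IsProbabilityMeasure (UN N) := emp_prob hN _
  have : IsProbabilityMeasure γ := by
    have : IsProbabilityMeasure (γ.map Prod.fst) := by rw [h1]; infer_instance
    constructor
    have := measure_univ (μ := γ.map Prod.fst)
    rwa [Measure.map_apply measurable_fst .univ, Set.preimage_univ] at this
  refine ⟨(UN N) ⊗ₘ (γ.condKernel.comap x hx), ?_, ?_⟩
  · exact Measure.fst_compProd _ _
  · have hg := γ.disintegrate γ.condKernel
    have hf : γ.fst = (UN N).map x := by rw [UN_map, ← h1]; rfl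
    have hm : Measurable (fun p : Fin N × Ed d => (x p.1, p.2)) := by fun_prop
    conv_rhs => rw [← hg, hf]
    have : IsProbabilityMeasure ((UN N).map x) := by rw [UN_map]; exact emp_prob hN x
    apply Measure.ext_of_lintegral
    intro f hfm
    rw [lintegral_map hfm hm, Measure.lintegral_compProd (f := fun p => f (x p.1, p.2)) (hfm.comp hm),
      Measure.lintegral_compProd hfm, lintegral_map _ hx]
    · rfl
    · exact hfm.lintegral_kernel_prod_right'

lemma cpl_prob {d N : ℕ} {ν : Measure (Ed d)} [IsProbabilityMeasure ν]
    {ρ : Measure (Fin N × Ed d)} (h : IsCpl ν ρ) : IsProbabilityMeasure ρ := by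
  constructor
  have := measure_univ (μ := ν)
  rw [← h.2] at this
  rwa [Measure.map_apply measurable_snd .univ, Set.preimage_univ] at this

lemma cpl_int {d N : ℕ} {ν : Measure (Ed d)} (hν : memP1 ν)
    {ρ : Measure (Fin N × Ed d)} (h : IsCpl ν ρ) (x : Fin N → Ed d) :
    Integrable (fun p => dist (x p.1) p.2) ρ := by
  have := hν.1
  have := cpl_prob h
  have hx : Measurable x := measurable_of_finite x
  have h1 : Integrable (fun y : Ed d => ‖y‖) ν := ⟨by fun_prop, hν.2⟩
  rw [← h.2] at h1
  have h2 : Integrable (fun p : Fin N × Ed d => ‖p.2‖) ρ := h1.comp_measurable measurable_snd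
  have h3 : Integrable (fun p : Fin N × Ed d => ‖x‖ + ‖p.2‖) ρ := (integrable_const _).add h2
  refine h3.mono' (by fun_prop) (.of_forall fun p => ?_)
  rw [Real.norm_of_nonneg dist_nonneg, dist_eq_norm]
  exact (norm_sub_le _ _).trans (by gcongr; exact norm_le_pi_norm x p.1)

lemma W1_le {d N : ℕ} {ν : Measure (Ed d)}
    {ρ : Measure (Fin N × Ed d)} (h : IsCpl ν ρ) (x : Fin N → Ed d) :
    W1 (emp x) ν ≤ ∫ p, dist (x p.1) p.2 ∂ρ := by
  have hx : Measurable x := measurable_of_finite x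
  have hm : Measurable (fun p : Fin N × Ed d => (x p.1, p.2)) := by fun_prop
  apply csInf_le
  · refine ⟨0, ?_⟩
    rintro r ⟨γ, -, -, rfl⟩
    exact integral_nonneg fun _ => dist_nonneg
  · refine ⟨ρ.map (fun p => (x p.1, p.2)), ?_, ?_, ?_⟩
    · rw [Measure.map_map measurable_fst hm, ← UN_map, ← h.1, Measure.map_map hx measurable_fst]
      rfl
    · rw [Measure.map_map measurable_snd hm, ← h.2]
      rfl
    · rw [integral_map hm.aemeasurable (by fun_prop)]

lemma W1_nonneg {X : Type*} [MeasurableSpace X] [PseudoMetricSpace X] (μ ν : Measure X) :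
    0 ≤ W1 μ ν := by
  apply Real.sInf_nonneg
  rintro r ⟨γ, -, -, rfl⟩
  exact integral_nonneg fun _ => dist_nonneg

lemma exists_cpl {d N : ℕ} (hN : 0 < N) {ν : Measure (Ed d)} [IsProbabilityMeasure ν]
    (x : Fin N → Ed d) {ε : ℝ} (hε : 0 < ε) :
    ∃ ρ : Measure (Fin N × Ed d), IsCpl ν ρ ∧ ∫ p, dist (x p.1) p.2 ∂ρ < W1 (emp x) ν + ε := by
  have hx : Measurable x := measurable_of_finite x
  have hm : Measurable (fun p : Fin N × Ed d => (x p.1, p.2)) := by fun_prop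
  have := emp_prob hN x
  have hne : {r | ∃ γ : Measure (Ed d × Ed d), γ.map Prod.fst = emp x ∧ γ.map Prod.snd = ν ∧
    r = ∫ p, dist p.1 p.2 ∂γ}.Nonempty := by
    refine ⟨_, (emp x).prod ν, ?_, ?_, rfl⟩
    · exact Measure.fst_prod
    · exact Measure.snd_prod
  obtain ⟨r, ⟨γ, h1, h2, rfl⟩, hlt⟩ := Real.lt_sInf_add_pos hne hε
  obtain ⟨ρ, hρ1, hρ2⟩ := lift_cpl hN x γ h1
  refine ⟨ρ, ⟨hρ1, ?_⟩, ?_⟩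
  · rw [← h2, ← hρ2, Measure.map_map measurable_snd hm]; rfl
  · rw [← hρ2, integral_map hm.aemeasurable (by fun_prop)] at hlt
    exact hlt

lemma cost_le {d N : ℕ} {ν : Measure (Ed d)} (hν : memP1 ν)
    {ρ : Measure (Fin N × Ed d)} (h : IsCpl ν ρ) (x z : Fin N → Ed d) :
    ∫ p, dist (x p.1) p.2 ∂ρ ≤ ∫ p, dist (z p.1) p.2 ∂ρ + dist x z := by
  have := hν.1
  have := cpl_prob h
  have : ∫ p, dist (z p.1) p.2 ∂ρ + dist x z = ∫ p, (dist (z p.1) p.2 + dist x z) ∂ρ := by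
    rw [integral_add (cpl_int hν h z) (integrable_const _)]; simp
  rw [this]
  refine integral_mono (cpl_int hν h x) ((cpl_int hν h z).add (integrable_const _)) fun p => ?_
  have := dist_triangle (x p.1) (z p.1) p.2
  have := dist_le_pi_dist x z p.1
  simp only
  linarith

lemma W1_lip {d N : ℕ} (hN : 0 < N) {ν : Measure (Ed d)} (hν : memP1 ν) :
    LipschitzWith 1 (fun x : Fin N → Ed d => W1 (emp x) ν) := by
  have := hν.1
  apply LipschitzWith.of_le_add
  intro x z
  apply _root_.le_of_forall_pos_le_add
  intro ε hε
  obtain ⟨ρ, h, hc⟩ := exists_cpl hN (ν := ν) z hε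
  have h1 := cost_le hν h x z
  have h2 := W1_le h x
  linarith

lemma exists_sel {d N : ℕ} (hN : 0 < N) {ν : Measure (Ed d)} (hν : memP1 ν) {ε : ℝ} (hε : 0 < ε) :
    ∃ (ρ : ℕ → Measure (Fin N × Ed d)) (k : (Fin N → Ed d) → ℕ), Measurable k ∧
      (∀ n, IsCpl ν (ρ n)) ∧
      ∀ x, ∫ p, dist (x p.1) p.2 ∂(ρ (k x)) ≤ W1 (emp x) ν + ε := by
  classical
  have := hν.1
  have hε3 : 0 < ε / 3 := by positivity
  have h := fun n : ℕ => exists_cpl hN (ν := ν)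
    (TopologicalSpace.denseSeq (Fin N → Ed d) n) hε3
  choose ρ hρ hc using h
  have hex : ∀ x : Fin N → Ed d, ∃ n,
      dist x (TopologicalSpace.denseSeq (Fin N → Ed d) n) < ε / 3 := fun x =>
    (TopologicalSpace.denseRange_denseSeq (Fin N → Ed d)).exists_dist_lt x hε3
  refine ⟨ρ, fun x => Nat.find (hex x), measurable_find hex ?_, hρ, ?_⟩
  · intro n
    exact measurableSet_lt (by fun_prop) measurable_const
  · intro x
    have h1 := Nat.find_spec (hex x)
    set n := Nat.find (hex x)
    set z := TopologicalSpace.denseSeq (Fin N → Ed d) n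
    have h2 := cost_le hν (hρ n) x z
    have h3 := (W1_lip hN hν).dist_le_mul z x
    have h4 := hc n
    rw [Real.dist_eq, dist_comm] at h3
    have h5 := le_abs_self (W1 (emp z) ν - W1 (emp x) ν)
    simp at h3
    linarith

lemma exists_perm_ext {q N : ℕ} (hqN : q ≤ N) (j : Fin q → Fin N) (hj : Function.Injective j) :
    ∃ σ : Equiv.Perm (Fin N), ∀ i, σ (Fin.castLE hqN i) = j i := by
  obtain ⟨σ, hσ⟩ := Equiv.Perm.exists_extending_pair (Fin.castLE hqN) j
    (Fin.castLE_injective hqN) hj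
  exact ⟨σ, fun i => by simpa using hσ i⟩

lemma law_inj {d N q : ℕ} (hqN : q ≤ N) (π : Measure (Fin N → Ed d))
    (hexch : ∀ σ : Equiv.Perm (Fin N), π.map (fun x => x ∘ σ) = π)
    (j : Fin q → Fin N) (hj : Function.Injective j) :
    π.map (fun x => x ∘ j) = π.map fun x (i : Fin q) => x (Fin.castLE hqN i) := by
  obtain ⟨σ, hσ⟩ := exists_perm_ext hqN j hj
  conv_rhs => rw [← hexch σ]
  rw [Measure.map_map (by fun_prop) (by fun_prop)]
  congr 1
  ext x i
  simp [hσ]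

lemma moment_eq {d N : ℕ} (hN : 0 < N) (π : Measure (Fin N → Ed d))
    (hexch : ∀ σ : Equiv.Perm (Fin N), π.map (fun x => x ∘ σ) = π) (i : Fin N) :
    ∫⁻ x, ‖x i‖ₑ ∂π = ∫⁻ x, ‖x ⟨0, hN⟩‖ₑ ∂π := by
  conv_rhs => rw [← hexch (Equiv.swap ⟨0, hN⟩ i)]
  rw [lintegral_map (by fun_prop) (by fun_prop)]
  simp

lemma UN_singleton {N : ℕ} (c : Fin N) : UN N {c} = (N : ℝ≥0∞)⁻¹ := by
  simp [UN, emp, Set.indicator]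

lemma collide {N q : ℕ} (hN : 0 < N) (a b : Fin q) (hab : a ≠ b) :
    (Measure.pi fun _ : Fin q => UN N) {i | i a = i b} = (N : ℝ≥0∞)⁻¹ := by
  have : IsProbabilityMeasure (UN N) := emp_prob hN _
  have hi := (iIndepFun_pi (μ := fun _ : Fin q => UN N) (X := fun _ => id)
    (fun _ => aemeasurable_id)).indepFun hab
  have hs : {i : Fin q → Fin N | i a = i b} =
      ⋃ c : Fin N, ((fun i => i a) ⁻¹' {c} ∩ (fun i => i b) ⁻¹' {c}) := by
    ext i; simp [eq_comm]
  have he : ∀ (t : Fin q) (c : Fin N),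
      (Measure.pi fun _ : Fin q => UN N) ((fun i => i t) ⁻¹' {c}) = (N : ℝ≥0∞)⁻¹ := by
    intro t c
    rw [← UN_singleton c]
    exact (measurePreserving_eval (fun _ : Fin q => UN N) t).measure_preimage
      (MeasurableSet.singleton c).nullMeasurableSet
  rw [hs, measure_iUnion]
  · have : ∀ c : Fin N, (Measure.pi fun _ : Fin q => UN N)
        ((fun i => i a) ⁻¹' {c} ∩ (fun i => i b) ⁻¹' {c}) = (N : ℝ≥0∞)⁻¹ * (N : ℝ≥0∞)⁻¹ := by
      intro c
      have := hi.measure_inter_preimage_eq_mul {c} {c} (.singleton c) (.singleton c)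
      simp only [id] at this
      rw [this, he, he]
    simp only [this, tsum_fintype, Finset.sum_const, Finset.card_univ, Fintype.card_fin,
      nsmul_eq_mul]
    rw [← mul_assoc, ENNReal.mul_inv_cancel (by simpa using hN.ne') (by simp), one_mul]
  · intro c e hce
    refine Set.disjoint_left.2 ?_
    rintro i ⟨h1, -⟩ ⟨h2, -⟩
    exact hce (h1.symm.trans h2)
  · intro c
    exact MeasurableSet.of_discrete

lemma noninj {N q : ℕ} (hN : 0 < N) :
    (Measure.pi fun _ : Fin q => UN N) {i | ¬ Function.Injective i} ≤
      (q : ℝ≥0∞) ^ 2 * (N : ℝ≥0∞)⁻¹ := by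
  have hs : {i : Fin q → Fin N | ¬ Function.Injective i} ⊆
      ⋃ p ∈ (Finset.univ : Finset (Fin q × Fin q)).filter (fun p => p.1 ≠ p.2),
        {i | i p.1 = i p.2} := by
    intro i hi
    simp only [Set.mem_ofPred_eq, Function.Injective, not_forall] at hi
    obtain ⟨a, b, h, hab⟩ := hi
    simp only [Set.mem_iUnion]
    exact ⟨(a, b), by simpa using hab, h⟩
  refine (measure_mono hs).trans ((measure_biUnion_finset_le _ _).trans ?_)
  calc _ = ∑ p ∈ (Finset.univ : Finset (Fin q × Fin q)).filter (fun p => p.1 ≠ p.2),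
          (N : ℝ≥0∞)⁻¹ := Finset.sum_congr rfl fun p hp => collide hN _ _ (by simpa using hp)
    _ ≤ ∑ p : Fin q × Fin q, (N : ℝ≥0∞)⁻¹ :=
        Finset.sum_le_sum_of_subset (Finset.filter_subset _ _)
    _ = _ := by simp [pow_two]

open Classical in
/-- Replace a non-injective tuple by the standard injective one. -/
def Jinj {N q : ℕ} (hqN : q ≤ N) (i : Fin q → Fin N) : Fin q → Fin N :=
  if Function.Injective i then i else Fin.castLE hqN

lemma Jinj_inj {N q : ℕ} (hqN : q ≤ N) (i : Fin q → Fin N) :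
    Function.Injective (Jinj hqN i) := by
  unfold Jinj
  split_ifs with h
  · exact h
  · exact Fin.castLE_injective hqN

lemma meas_ev {d N q : ℕ} (j : (Fin q → Fin N) → Fin N) :
    Measurable (fun p : (Fin N → Ed d) × (Fin q → Fin N) => p.1 (j p.2)) := by
  refine measurable_from_prod_countable_left fun i => ?_
  exact measurable_pi_apply (j i)

lemma meas_cost1 {d N : ℕ} (x : Fin N → Ed d) :
    Measurable (fun p : Fin N × Ed d => ‖x p.1 - p.2‖ₑ) := by
  have hx : Measurable x := measurable_of_finite x
  exact ((hx.comp measurable_fst).sub measurable_snd).enorm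

lemma meas_costq {d N q : ℕ} (t : Fin q) :
    Measurable (fun p : (Fin N → Ed d) × (Fin q → Fin N × Ed d) =>
      ‖p.1 (p.2 t).1 - (p.2 t).2‖ₑ) := by
  have h0 : Measurable (fun p : (Fin N → Ed d) × Fin N => p.1 p.2) :=
    measurable_from_prod_countable_left fun i => measurable_pi_apply i
  have h1 : Measurable (fun p : (Fin N → Ed d) × (Fin q → Fin N × Ed d) => p.2 t) :=
    (measurable_pi_apply t).comp measurable_snd
  have h2 : Measurable (fun p : (Fin N → Ed d) × (Fin q → Fin N × Ed d) => (p.1, (p.2 t).1)) :=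
    measurable_fst.prodMk h1.fst
  have h3 : Measurable (fun p : (Fin N → Ed d) × (Fin q → Fin N × Ed d) => p.1 (p.2 t).1) :=
    h0.comp h2
  exact (h3.sub h1.snd).enorm

lemma l2cost_le {d q : ℕ} (x y : Fin q → Ed d) : l2cost x y ≤ ∑ i, ‖x i - y i‖ := by
  unfold l2cost
  rw [Real.sqrt_le_left (Finset.sum_nonneg fun _ _ => norm_nonneg _)]
  exact Finset.sum_sq_le_sq_sum_of_nonneg fun _ _ => norm_nonneg _

lemma second_part {d N q : ℕ} (hN : 0 < N) (hqN : q ≤ N) (π : Measure (Fin N → Ed d))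
    [IsProbabilityMeasure π]
    (hexch : ∀ σ : Equiv.Perm (Fin N), π.map (fun x => x ∘ σ) = π) :
    ∫⁻ p, ∑ t, ‖p.1 (Jinj hqN p.2 t) - p.1 (p.2 t)‖ₑ ∂(π.prod (Measure.pi fun _ : Fin q => UN N))
      ≤ 2 * ((q : ℝ≥0∞) ^ 3 * (N : ℝ≥0∞)⁻¹) * ∫⁻ x, ‖x ⟨0, hN⟩‖ₑ ∂π := by
  classical
  have : IsProbabilityMeasure (UN N) := emp_prob hN _
  set M := ∫⁻ x, ‖x ⟨0, hN⟩‖ₑ ∂π with hM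
  have hmeas : Measurable (fun p : (Fin N → Ed d) × (Fin q → Fin N) =>
      ∑ t, ‖p.1 (Jinj hqN p.2 t) - p.1 (p.2 t)‖ₑ) := by
    refine Finset.measurable_sum _ fun t _ => ?_
    exact ((meas_ev fun i => Jinj hqN i t).sub (meas_ev fun i => i t)).enorm
  rw [lintegral_prod_symm _ hmeas.aemeasurable]
  have hb : ∀ i : Fin q → Fin N,
      ∫⁻ x, ∑ t, ‖x (Jinj hqN i t) - x (i t)‖ₑ ∂π ≤
        {i : Fin q → Fin N | ¬ Function.Injective i}.indicator
          (fun _ => 2 * (q : ℝ≥0∞) * M) i := by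
    intro i
    by_cases hi : Function.Injective i
    · simp [Jinj, hi]
    · rw [Set.indicator_of_mem (by exact hi)]
      calc ∫⁻ x, ∑ t, ‖x (Jinj hqN i t) - x (i t)‖ₑ ∂π
          ≤ ∫⁻ x, ∑ t, (‖x (Jinj hqN i t)‖ₑ + ‖x (i t)‖ₑ) ∂π :=
            lintegral_mono fun x => Finset.sum_le_sum fun t _ => enorm_sub_le
        _ = ∑ t : Fin q, (M + M) := by
            rw [lintegral_finsetSum _ (by fun_prop)]
            refine Finset.sum_congr rfl fun t _ => ?_
            rw [lintegral_add_left (by fun_prop), moment_eq hN π hexch (Jinj hqN i t),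
              moment_eq hN π hexch (i t)]
        _ = 2 * (q : ℝ≥0∞) * M := by
            simp [← two_mul]; ring
  refine (lintegral_mono hb).trans ?_
  rw [lintegral_indicator_const MeasurableSet.of_discrete]
  calc _ ≤ 2 * (q : ℝ≥0∞) * M * ((q : ℝ≥0∞) ^ 2 * (N : ℝ≥0∞)⁻¹) := by
        gcongr; exact noninj hN
    _ = _ := by ring

set_option maxHeartbeats 600000 in
lemma key {d N : ℕ} (hN : 0 < N)
    (π : Measure (Fin N → Ed d)) (hπ : IsProbabilityMeasure π)
    (hπ1 : HasFiniteIntegral (fun x : Fin N → Ed d => Real.sqrt (∑ i, ‖x i‖ ^ 2)) π)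
    (hexch : ∀ σ : Equiv.Perm (Fin N), π.map (fun x => x ∘ σ) = π)
    (ν : Measure (Ed d)) (hν : memP1 ν)
    (q : ℕ) (hqN : q ≤ N) {ε : ℝ} (hε : 0 < ε) :
    W1q (π.map fun x (i : Fin q) => x (Fin.castLE hqN i)) (Measure.pi fun _ : Fin q => ν)
      ≤ q * (∫ x, W1 (emp x) ν ∂π + ε)
        + 2 * ((q : ℝ) ^ 3 / N) * ∫ x, ‖x ⟨0, hN⟩‖ ∂π := by
  have hνp := hν.1
  have hU : IsProbabilityMeasure (UN N) := emp_prob hN _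
  obtain ⟨ρ, k, hk, hρ, hc⟩ := exists_sel hN hν hε
  have hρp : ∀ n, IsProbabilityMeasure (ρ n) := fun n => cpl_prob (hρ n)
  -- integrability facts
  have hnorm : Integrable (fun x : Fin N → Ed d => ‖x‖) π := by
    have h : Integrable (fun x : Fin N → Ed d => Real.sqrt (∑ i, ‖x i‖ ^ 2)) π :=
      ⟨(by fun_prop : Measurable _).aestronglyMeasurable, hπ1⟩
    refine h.mono' (by fun_prop) (.of_forall fun x => ?_)
    rw [norm_norm, pi_norm_le_iff_of_nonneg (Real.sqrt_nonneg _)]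
    intro i
    apply Real.le_sqrt_of_sq_le
    exact Finset.single_le_sum (f := fun i => ‖x i‖ ^ 2) (fun _ _ => by positivity)
      (Finset.mem_univ i)
  have hx0 : Integrable (fun x : Fin N → Ed d => ‖x ⟨0, hN⟩‖) π :=
    hnorm.mono' (measurable_pi_apply _).norm.aestronglyMeasurable (.of_forall fun x => by
      rw [norm_norm]; exact norm_le_pi_norm x _)
  have hWint : Integrable (fun x : Fin N → Ed d => W1 (emp x) ν) π := by
    have h : Integrable (fun x : Fin N → Ed d => W1 (emp (0 : Fin N → Ed d)) ν + ‖x‖) π :=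
      (integrable_const _).add hnorm
    refine h.mono' (W1_lip hN hν).continuous.aestronglyMeasurable (.of_forall fun x => ?_)
    rw [Real.norm_of_nonneg (W1_nonneg _ _)]
    have h3 := (W1_lip hN hν).dist_le_mul x 0
    rw [Real.dist_eq] at h3
    have h5 := le_abs_self (W1 (emp x) ν - W1 (emp (0 : Fin N → Ed d)) ν)
    simp only [NNReal.coe_one, one_mul, dist_zero_right] at h3
    linarith
  -- the kernel and the global coupling
  let κ0 : Kernel ℕ (Fin q → Fin N × Ed d) :=
    Kernel.ofFunOfCountable fun n => Measure.pi fun _ : Fin q => ρ n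
  have hκ0 : IsMarkovKernel κ0 := ⟨fun n => by
    change IsProbabilityMeasure (Measure.pi fun _ : Fin q => ρ n); infer_instance⟩
  let κ : Kernel (Fin N → Ed d) (Fin q → Fin N × Ed d) := κ0.comap k hk
  have hκa : ∀ x, κ x = Measure.pi fun _ : Fin q => ρ (k x) := fun x => rfl
  let Γ : Measure ((Fin N → Ed d) × (Fin q → Fin N × Ed d)) := π ⊗ₘ κ
  let idx : (Fin q → Fin N × Ed d) → (Fin q → Fin N) := fun w t => (w t).1
  let ys : (Fin q → Fin N × Ed d) → (Fin q → Ed d) := fun w t => (w t).2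
  have hidx : Measurable idx := by fun_prop
  have hys : Measurable ys := by fun_prop
  have hκidx : ∀ x, (κ x).map idx = Measure.pi fun _ : Fin q => UN N := by
    intro x
    have : ∀ _ : Fin q, SigmaFinite ((ρ (k x)).map Prod.fst) := fun _ => by
      rw [(hρ (k x)).1]; infer_instance
    rw [hκa, Measure.pi_map_pi (f := fun _ : Fin q => (Prod.fst : Fin N × Ed d → Fin N))
      (fun _ => measurable_fst.aemeasurable)]
    simp only [(hρ (k x)).1]
  have hκys : ∀ x, (κ x).map ys = Measure.pi fun _ : Fin q => ν := by
    intro x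
    have : ∀ _ : Fin q, SigmaFinite ((ρ (k x)).map Prod.snd) := fun _ => by
      rw [(hρ (k x)).2]; infer_instance
    rw [hκa, Measure.pi_map_pi (f := fun _ : Fin q => (Prod.snd : Fin N × Ed d → Ed d))
      (fun _ => measurable_snd.aemeasurable)]
    simp only [(hρ (k x)).2]
  have hpm : Measurable (fun p : (Fin N → Ed d) × (Fin q → Fin N × Ed d) => (p.1, idx p.2)) := by
    fun_prop
  have hΓprod : Γ.map (fun p => (p.1, idx p.2)) = π.prod (Measure.pi fun _ : Fin q => UN N) := by
    apply Measure.ext_of_lintegral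
    intro f hf
    rw [lintegral_map hf hpm, Measure.lintegral_compProd (f := fun p => f (p.1, idx p.2))
      (hf.comp hpm), lintegral_prod _ hf.aemeasurable]
    refine lintegral_congr fun x => ?_
    rw [← hκidx x, lintegral_map (by fun_prop) hidx]
  have hsel : Measurable (fun p : (Fin N → Ed d) × (Fin q → Fin N) => p.1 ∘ Jinj hqN p.2) :=
    measurable_pi_iff.2 fun t => meas_ev fun i => Jinj hqN i t
  have hselΓ : Measurable (fun p : (Fin N → Ed d) × (Fin q → Fin N × Ed d) =>
      p.1 ∘ Jinj hqN (idx p.2)) := hsel.comp hpm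
  have hΦ : Measurable (fun p : (Fin N → Ed d) × (Fin q → Fin N × Ed d) =>
      (p.1 ∘ Jinj hqN (idx p.2), ys p.2)) := hselΓ.prodMk (by fun_prop)
  set Φ := (fun p : (Fin N → Ed d) × (Fin q → Fin N × Ed d) =>
      (p.1 ∘ Jinj hqN (idx p.2), ys p.2)) with hΦdef
  have hm1 : (Γ.map Φ).map Prod.fst = π.map fun x (i : Fin q) => x (Fin.castLE hqN i) := by
    rw [Measure.map_map measurable_fst hΦ]
    have : (Prod.fst ∘ Φ) = (fun p : (Fin N → Ed d) × (Fin q → Fin N) => p.1 ∘ Jinj hqN p.2) ∘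
      (fun p => (p.1, idx p.2)) := rfl
    rw [this, ← Measure.map_map hsel hpm, hΓprod]
    apply Measure.ext_of_lintegral
    intro f hf
    rw [lintegral_map hf hsel, lintegral_prod_symm (fun p : (Fin N → Ed d) × (Fin q → Fin N) => f (p.1 ∘ Jinj hqN p.2))
      (hf.comp hsel).aemeasurable]
    have : ∀ i : Fin q → Fin N, ∫⁻ x, f (x ∘ Jinj hqN i) ∂π =
        ∫⁻ y, f y ∂(π.map fun x (i : Fin q) => x (Fin.castLE hqN i)) := by
      intro i
      rw [← law_inj hqN π hexch _ (Jinj_inj hqN i), lintegral_map hf (by fun_prop)]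
    simp only [this]
    simp
  have hm2 : (Γ.map Φ).map Prod.snd = Measure.pi fun _ : Fin q => ν := by
    rw [Measure.map_map measurable_snd hΦ]
    apply Measure.ext_of_lintegral
    intro f hf
    rw [lintegral_map hf (measurable_snd.comp hΦ)]
    change ∫⁻ p, f (ys p.2) ∂Γ = _
    rw [Measure.lintegral_compProd (f := fun p => f (ys p.2)) (by fun_prop)]
    have : ∀ x, ∫⁻ w, f (ys w) ∂(κ x) = ∫⁻ y, f y ∂(Measure.pi fun _ : Fin q => ν) := by
      intro x
      rw [← hκys x, lintegral_map hf hys]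
    simp only [this]
    simp
  have hl2 : Measurable (fun p : (Fin q → Ed d) × (Fin q → Ed d) => l2cost p.1 p.2) := by
    unfold l2cost
    fun_prop
  have hl2nn : ∀ x y : Fin q → Ed d, 0 ≤ l2cost x y := fun x y => Real.sqrt_nonneg _
  have hWle : W1q (π.map fun x (i : Fin q) => x (Fin.castLE hqN i))
      (Measure.pi fun _ : Fin q => ν) ≤ ∫ p, l2cost p.1 p.2 ∂(Γ.map Φ) := by
    apply csInf_le
    · refine ⟨0, ?_⟩
      rintro r ⟨γ, -, -, rfl⟩
      exact integral_nonneg fun _ => hl2nn _ _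
    · exact ⟨_, hm1, hm2, rfl⟩
  refine hWle.trans ?_
  rw [integral_eq_lintegral_of_nonneg_ae (.of_forall fun _ => hl2nn _ _)
    hl2.aestronglyMeasurable]
  have hWi : 0 ≤ ∫ x, W1 (emp x) ν ∂π := integral_nonneg fun _ => W1_nonneg _ _
  have hxi : 0 ≤ ∫ x, ‖x ⟨0, hN⟩‖ ∂π := integral_nonneg fun _ => norm_nonneg _
  refine ENNReal.toReal_le_of_le_ofReal (by positivity) ?_
  rw [lintegral_map (by fun_prop) hΦ]
  have hmA' : ∀ t : Fin q, Measurable (fun p : (Fin N → Ed d) × (Fin q → Fin N × Ed d) =>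
      ‖p.1 (idx p.2 t) - ys p.2 t‖ₑ) := fun t => meas_costq t
  have hmB : Measurable (fun p : (Fin N → Ed d) × (Fin q → Fin N) =>
      ∑ t, ‖p.1 (Jinj hqN p.2 t) - p.1 (p.2 t)‖ₑ) := by
    refine Finset.measurable_sum _ fun t _ => ?_
    exact ((meas_ev fun i => Jinj hqN i t).sub (meas_ev fun i => i t)).enorm
  have hA : ∀ t : Fin q, ∫⁻ p, ‖p.1 (idx p.2 t) - ys p.2 t‖ₑ ∂Γ ≤
      ENNReal.ofReal (∫ x, W1 (emp x) ν ∂π + ε) := by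
    intro t
    rw [Measure.lintegral_compProd (hmA' t)]
    have e1 : ∫ x, W1 (emp x) ν ∂π + ε = ∫ x, (W1 (emp x) ν + ε) ∂π := by
      rw [integral_add hWint (integrable_const _)]; simp
    have e3 : Integrable (fun x : Fin N → Ed d => W1 (emp x) ν + ε) π :=
      hWint.add (integrable_const _)
    rw [e1, ofReal_integral_eq_lintegral_ofReal e3
      (.of_forall fun x => add_nonneg (W1_nonneg _ _) hε.le)]
    refine lintegral_mono fun x => ?_
    have e2 : ∫⁻ w, ‖x (idx w t) - ys w t‖ₑ ∂(κ x) =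
        ∫⁻ p, ‖x p.1 - p.2‖ₑ ∂(ρ (k x)) := by
      rw [hκa]
      have hmp := measurePreserving_eval (fun _ : Fin q => ρ (k x)) t
      have hmx : Measurable (fun p : Fin N × Ed d => ‖x p.1 - p.2‖ₑ) := meas_cost1 x
      exact hmp.lintegral_comp (f := fun p => ‖x p.1 - p.2‖ₑ)
        hmx
    simp only
    rw [e2]
    refine le_trans (le_of_eq ?_) (ENNReal.ofReal_le_ofReal (hc x))
    rw [ofReal_integral_eq_lintegral_ofReal (cpl_int hν (hρ _) x)
      (.of_forall fun _ => dist_nonneg)]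
    refine lintegral_congr fun p => ?_
    rw [dist_eq_norm, ofReal_norm]
  calc ∫⁻ p, ENNReal.ofReal (l2cost (Φ p).1 (Φ p).2) ∂Γ
      ≤ ∫⁻ p, (∑ t, ‖p.1 (idx p.2 t) - ys p.2 t‖ₑ +
          ∑ t, ‖p.1 (Jinj hqN (idx p.2) t) - p.1 (idx p.2 t)‖ₑ) ∂Γ := by
        refine lintegral_mono fun p => ?_
        refine (ENNReal.ofReal_le_ofReal (l2cost_le _ _)).trans ?_
        rw [ENNReal.ofReal_sum_of_nonneg (fun _ _ => norm_nonneg _), ← Finset.sum_add_distrib]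
        refine Finset.sum_le_sum fun t _ => ?_
        rw [ofReal_norm, add_comm]
        have : (Φ p).1 t - (Φ p).2 t = (p.1 (Jinj hqN (idx p.2) t) - p.1 (idx p.2 t)) +
          (p.1 (idx p.2 t) - ys p.2 t) := by simp [hΦdef]
        rw [this]
        exact enorm_add_le _ _
    _ = ∑ t, ∫⁻ p, ‖p.1 (idx p.2 t) - ys p.2 t‖ₑ ∂Γ +
        ∫⁻ p, ∑ t, ‖p.1 (Jinj hqN p.2 t) - p.1 (p.2 t)‖ₑ
          ∂(π.prod (Measure.pi fun _ : Fin q => UN N)) := by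
        rw [lintegral_add_left (Finset.measurable_sum _ fun t _ => hmA' t),
          lintegral_finsetSum _ (fun t _ => hmA' t), ← hΓprod, lintegral_map hmB hpm]
    _ ≤ ∑ t : Fin q, ENNReal.ofReal (∫ x, W1 (emp x) ν ∂π + ε) +
        2 * ((q : ℝ≥0∞) ^ 3 * (N : ℝ≥0∞)⁻¹) * ∫⁻ x, ‖x ⟨0, hN⟩‖ₑ ∂π :=
        add_le_add (Finset.sum_le_sum fun t _ => hA t) (second_part hN hqN π hexch)
    _ = _ := by
        have hN' : (0 : ℝ) < N := by exact_mod_cast hN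
        have hWe : 0 ≤ ∫ x, W1 (emp x) ν ∂π + ε := by positivity
        generalize ∫ x, W1 (emp x) ν ∂π + ε = A at hWe
        rw [ENNReal.ofReal_add (by positivity) (by positivity),
          ENNReal.ofReal_mul (by positivity), ENNReal.ofReal_mul (by positivity),
          ENNReal.ofReal_mul (by positivity), ENNReal.ofReal_div_of_pos hN',
          ENNReal.ofReal_pow (by positivity),
          ofReal_integral_eq_lintegral_ofReal hx0 (.of_forall fun _ => norm_nonneg _)]
        simp [div_eq_mul_inv]

/-- **tensorization lemma.** For exchangeable `(X^1,…,X^N)` with joint law in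
`P₁((ℝ^d)^N)` and `ν ∈ P₁(ℝ^d)`, the law `μ^{N,q}` of the first `q` coordinates satisfies
`W₁(μ^{N,q}, ν^{⊗q}) ≤ q·E[W₁(m(X), ν)] + 2(q³/N)·M₁(μ^{N,1})`. -/
theorem stmt3 {d N : ℕ} (hN : 0 < N)
    (π : Measure (Fin N → Ed d)) (hπ : IsProbabilityMeasure π)
    (hπ1 : HasFiniteIntegral (fun x : Fin N → Ed d => Real.sqrt (∑ i, ‖x i‖ ^ 2)) π)
    (hexch : ∀ σ : Equiv.Perm (Fin N), π.map (fun x => x ∘ σ) = π)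
    (ν : Measure (Ed d)) (hν : memP1 ν)
    (q : ℕ) (hq1 : 1 ≤ q) (hqN : q ≤ N) :
    W1q (π.map fun x (i : Fin q) => x (Fin.castLE hqN i)) (Measure.pi fun _ : Fin q => ν)
      ≤ q * ∫ x, W1 (emp x) ν ∂π
        + 2 * ((q : ℝ) ^ 3 / N) * ∫ x, ‖x ⟨0, hN⟩‖ ∂π := by
  refine _root_.le_of_forall_pos_le_add fun ε hε => ?_
  have hq : (0 : ℝ) < q := by exact_mod_cast hq1
  refine (key hN π hπ hπ1 hexch ν hν q hqN (div_pos hε hq)).trans (le_of_eq ?_)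
  field_simp
  ring
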